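/- Let h : ℝ → ℝ be continuous and 2π-periodic, and define g(z) = exp( (1/(2π)) ∫₀^{2π} ((e^{it}+z)/(e^{it}−z)) h(t) dt ) for z in the open unit disk D ⊂ ℂ. Then g is analytic and nonvanishing on D, and for every z ∈ D, g'(z)/g(z) = (1/(2π)) ∫₀^{2π} ( 2 e^{it} / (e^{it}−z)² ) h(t) dt. -/

import Mathlib

open Complex Metric Set Real

/-- A point of the disk of radius `r` stays at distance at least `1 - r` from the unit circle. -/
theorem one_sub_le_norm_exp_mul_I_sub {r : ℝ} {z : ℂ} (hz : z ∈ ball (0:ℂ) r) (t : ℝ) :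
    1 - r ≤ ‖Complex.exp (t * Complex.I) - z‖ := by
  have h₁ := norm_sub_norm_le (Complex.exp (t * Complex.I)) z
  rw [Complex.norm_exp_ofReal_mul_I] at h₁
  have h₂ := mem_ball_zero_iff.mp hz
  linarith

theorem exp_mul_I_sub_ne_zero {z : ℂ} (hz : z ∈ ball (0:ℂ) 1) (t : ℝ) :
    Complex.exp (t * Complex.I) - z ≠ 0 := by
  rw [sub_ne_zero]
  rintro rfl
  simp [Complex.norm_exp_ofReal_mul_I] at hz

theorem hasDerivAt_schwarz_kernel {w z : ℂ} (hz : w - z ≠ 0) :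
    HasDerivAt (fun z => (w + z) / (w - z)) (2 * w / (w - z) ^ 2) z := by
  refine (((hasDerivAt_id' z).const_add w).fun_div ((hasDerivAt_id' z).const_sub w) hz).congr_deriv ?_
  ring

/-- The Schwarz integral of a continuous density can be differentiated under the integral sign. -/
theorem hasDerivAt_schwarz_integral {h : ℝ → ℝ} (hcont : Continuous h) (a b : ℝ) {z : ℂ}
    (hz : z ∈ ball (0:ℂ) 1) :
    HasDerivAt
      (fun z => ∫ t in a..b,
        ((Complex.exp (t * Complex.I) + z) / (Complex.exp (t * Complex.I) - z)) * (h t : ℂ))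
      (∫ t in a..b,
        (2 * Complex.exp (t * Complex.I) / (Complex.exp (t * Complex.I) - z) ^ 2) * (h t : ℂ))
      z := by
  obtain ⟨r, hzr, hr⟩ := exists_between (mem_ball_zero_iff.mp hz)
  have hsub : ball (0:ℂ) r ⊆ ball 0 1 := ball_subset_ball hr.le
  have hcontK : ∀ x ∈ ball (0:ℂ) 1, Continuous fun t : ℝ =>
      ((Complex.exp (t * Complex.I) + x) / (Complex.exp (t * Complex.I) - x)) * (h t : ℂ) :=
    fun x hx => (Continuous.div (by fun_prop) (by fun_prop) (exp_mul_I_sub_ne_zero hx)).mul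
      (by fun_prop)
  have hcontK' : Continuous fun t : ℝ =>
      (2 * Complex.exp (t * Complex.I) / (Complex.exp (t * Complex.I) - z) ^ 2) * (h t : ℂ) :=
    (Continuous.div (by fun_prop) (by fun_prop)
      fun t => pow_ne_zero 2 (exp_mul_I_sub_ne_zero hz t)).mul (by fun_prop)
  refine (intervalIntegral.hasDerivAt_integral_of_dominated_loc_of_deriv_le
    (F := fun z t =>
      ((Complex.exp (t * Complex.I) + z) / (Complex.exp (t * Complex.I) - z)) * (h t : ℂ))
    (F' := fun z t =>
      (2 * Complex.exp (t * Complex.I) / (Complex.exp (t * Complex.I) - z) ^ 2) * (h t : ℂ))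
    (bound := fun t => 2 / (1 - r) ^ 2 * |h t|) (s := ball 0 r)
    (isOpen_ball.mem_nhds (mem_ball_zero_iff.mpr hzr)) ?_
    ((hcontK z hz).intervalIntegrable _ _) hcontK'.aestronglyMeasurable ?_
    ((by fun_prop : Continuous fun t => 2 / (1 - r) ^ 2 * |h t|).intervalIntegrable _ _) ?_).2
  · filter_upwards [isOpen_ball.mem_nhds hz] with x hx
    exact (hcontK x hx).aestronglyMeasurable
  · refine .of_forall fun t _ x hx => ?_
    have hpos : 0 < 1 - r := sub_pos.mpr hr
    rw [norm_mul, norm_div, norm_mul, norm_pow, Complex.norm_exp_ofReal_mul_I, Complex.norm_real,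
      Complex.norm_ofNat, mul_one, Real.norm_eq_abs]
    gcongr
    exact one_sub_le_norm_exp_mul_I_sub hx t
  · exact .of_forall fun t _ x hx =>
      (hasDerivAt_schwarz_kernel (exp_mul_I_sub_ne_zero (hsub hx) t)).mul_const _

/-- For `h : ℝ → ℝ` continuous and `2π`-periodic, the Schwarz-type
function `g(z) = exp((1/2π)∫₀^{2π} (e^{it}+z)/(e^{it}-z) h(t) dt)` is analytic and
nonvanishing on the unit disk, and
`g'(z)/g(z) = (1/2π)∫₀^{2π} 2e^{it}/(e^{it}-z)² h(t) dt`. -/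
theorem stmt_13 (h : ℝ → ℝ) (hcont : Continuous h) (hper : Function.Periodic h (2 * Real.pi))
    (g : ℂ → ℂ)
    (hg : ∀ z ∈ ball (0:ℂ) 1,
      g z = Complex.exp ((1 / (2 * (Real.pi : ℂ))) *
        ∫ t in (0:ℝ)..(2 * Real.pi),
          ((Complex.exp (t * Complex.I) + z) / (Complex.exp (t * Complex.I) - z)) * (h t : ℂ))) :
    DifferentiableOn ℂ g (ball (0:ℂ) 1) ∧
    (∀ z ∈ ball (0:ℂ) 1, g z ≠ 0) ∧
    (∀ z ∈ ball (0:ℂ) 1,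
      deriv g z / g z = (1 / (2 * (Real.pi : ℂ))) *
        ∫ t in (0:ℝ)..(2 * Real.pi),
          (2 * Complex.exp (t * Complex.I) / (Complex.exp (t * Complex.I) - z) ^ 2) * (h t : ℂ)) := by
  have hne : ∀ z ∈ ball (0:ℂ) 1, g z ≠ 0 := fun z hz => by
    rw [hg z hz]
    exact Complex.exp_ne_zero _
  have hderiv : ∀ z ∈ ball (0:ℂ) 1, HasDerivAt g (g z * ((1 / (2 * (Real.pi : ℂ))) *
      ∫ t in (0:ℝ)..(2 * Real.pi),
        (2 * Complex.exp (t * Complex.I) / (Complex.exp (t * Complex.I) - z) ^ 2) * (h t : ℂ)))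
      z := fun z hz => by
    rw [hg z hz]
    refine ((hasDerivAt_schwarz_integral hcont 0 (2 * Real.pi) hz).const_mul
      (1 / (2 * (Real.pi : ℂ)))).cexp.congr_of_eventuallyEq ?_
    filter_upwards [isOpen_ball.mem_nhds hz] with x hx using hg x hx
  exact ⟨fun z hz => (hderiv z hz).differentiableAt.differentiableWithinAt, hne,
    fun z hz => by rw [(hderiv z hz).deriv, mul_div_cancel_left₀ _ (hne z hz)]⟩
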